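/- Let α > 0 and β > 0, let h : [0,1] → ℝ be Lipschitz with |h'| ≤ L almost everywhere, let Bh = E h(Z) for Z with the Beta distribution B(α,β), and let f(w) = w^{−α}(1−w)^{−β} ∫₀^w u^{α−1}(1−u)^{β−1}(h(u) − Bh) du for w ∈ (0,1). Then sup_{w ∈ (0,1)} |f'(w)| ≤ b₀(α,β) · sup_{x ∈ [0,1]} |h(x) − Bh| + b₁(α,β) · L ≤ (b₀(α,β) + b₁(α,β)) · L, where b₀ and b₁ are the explicit constants given in the context. -/

import Mathlib

open MeasureTheory intervalIntegral

/-- Expectation `E h(Z)` for `Z ∼ B(a,b)`, the Beta distribution with density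
`x^{a-1} (1-x)^{b-1} / B(a,b)` on `[0,1]`, where `B(a,b) = Γ(a)Γ(b)/Γ(a+b)`. -/
noncomputable def betaExp (a b : ℝ) (h : ℝ → ℝ) : ℝ :=
  ∫ x in Set.Ioo (0 : ℝ) 1,
    (Real.Gamma (a + b) / (Real.Gamma a * Real.Gamma b))
      * x ^ (a - 1) * (1 - x) ^ (b - 1) * h x

/-- The constant `b₀(a,b)` of Lemma 3.3 (Lemma `lem:allbounds`). -/
noncomputable def b₀ (a b : ℝ) : ℝ :=
  if a ≤ 2 then
    (if b ≤ 2 then 4 * max |a - 1| |b - 1|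
     else (a + b - 2) ^ 2 * max (|a - 1| / a ^ 2) ((b - 1) / (b - 2) ^ 2))
  else
    (if b ≤ 2 then (a + b - 2) ^ 2 * max ((a - 1) / (a - 2) ^ 2) (|b - 1| / b ^ 2)
     else (a + b - 2) ^ 2 * max (1 / (a - 1)) (1 / (b - 1)))

/-- The constant `b₁(a,b)` of Lemma 3.3 (Lemma `lem:allbounds`). -/
noncomputable def b₁ (a b : ℝ) : ℝ :=
  if a ≤ 2 then
    (if b ≤ 2 then 4 * (1 + max a b / (a + b))
     else (a + b - 2) ^ 2 / min a (b - 2) ^ 2 + 2 * max 1 (b / (b - 2)))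
  else
    (if b ≤ 2 then (a + b - 2) ^ 2 / min (a - 2) b ^ 2 + 2 * max (a / (a - 2)) 1
     else (a + b - 2) ^ 2 / min (a - 1) (b - 1) ^ 2
            + 2 * max (a / (a - 1)) (b / (b - 1)))

/-- The unnormalised Beta weight `u ^ a * (1 - u) ^ b`. -/
noncomputable def betaWeight (a b u : ℝ) : ℝ := u ^ a * (1 - u) ^ b

section BetaWeight

open Set

variable {a b : ℝ}

lemma betaWeight_pos {u : ℝ} (hu : u ∈ Ioo (0 : ℝ) 1) : 0 < betaWeight a b u :=
  mul_pos (Real.rpow_pos_of_pos hu.1 _) (Real.rpow_pos_of_pos (by linarith [hu.2]) _)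

lemma betaWeight_nonneg {u : ℝ} (hu : u ∈ Icc (0 : ℝ) 1) : 0 ≤ betaWeight a b u :=
  mul_nonneg (Real.rpow_nonneg hu.1 _) (Real.rpow_nonneg (by linarith [hu.2]) _)

lemma betaWeight_one_sub (u : ℝ) : betaWeight a b (1 - u) = betaWeight b a u := by
  simp [betaWeight, mul_comm]

lemma betaWeight_add_one_left {u : ℝ} (hu : u ∈ Ioo (0 : ℝ) 1) :
    betaWeight (a + 1) b u = u * betaWeight a b u := by
  simp only [betaWeight, Real.rpow_add_one hu.1.ne']; ring

lemma betaWeight_add_one_right {u : ℝ} (hu : u ∈ Ioo (0 : ℝ) 1) :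
    betaWeight a (b + 1) u = (1 - u) * betaWeight a b u := by
  have : (1 - u) ≠ 0 := by linarith [hu.2]
  simp only [betaWeight, Real.rpow_add_one this]; ring

lemma betaWeight_eq_mul_betaWeight_sub_one {u : ℝ} (hu : u ∈ Ioo (0 : ℝ) 1) :
    betaWeight a b u = u * (1 - u) * betaWeight (a - 1) (b - 1) u := by
  have h₁ := betaWeight_add_one_left (a := a - 1) (b := b) hu
  have h₂ := betaWeight_add_one_right (a := a - 1) (b := b - 1) hu
  rw [sub_add_cancel] at h₁ h₂
  rw [h₁, h₂]; ring

lemma betaWeight_zero (ha : 0 < a) : betaWeight a b 0 = 0 := by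
  simp [betaWeight, ha.ne']

lemma betaWeight_one (hb : 0 < b) : betaWeight a b 1 = 0 := by
  simp [betaWeight, hb.ne']

lemma continuous_betaWeight (ha : 0 < a) (hb : 0 < b) : Continuous (betaWeight a b) :=
  (continuous_id.rpow_const fun _ => .inr ha.le).mul
    ((continuous_const.sub continuous_id).rpow_const fun _ => .inr hb.le)

lemma hasDerivAt_betaWeight {u : ℝ} (hu : u ∈ Ioo (0 : ℝ) 1) :
    HasDerivAt (betaWeight a b) ((a - (a + b) * u) * betaWeight (a - 1) (b - 1) u) u := by
  have hu' : 1 - u ≠ 0 := by linarith [hu.2]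
  have h := (Real.hasDerivAt_rpow_const (p := a) (.inl hu.1.ne')).mul
    (((hasDerivAt_id u).const_sub 1).rpow_const (p := b) (.inl hu'))
  refine h.congr_deriv ?_
  have e₁ : u ^ a = u ^ (a - 1) * u := by rw [← Real.rpow_add_one hu.1.ne', sub_add_cancel]
  have e₂ : (1 - u) ^ b = (1 - u) ^ (b - 1) * (1 - u) := by
    rw [← Real.rpow_add_one hu', sub_add_cancel]
  simp only [betaWeight, id, e₁, e₂]
  ring

lemma intervalIntegrable_betaWeight (ha : 0 < a) (hb : 0 < b) :
    IntervalIntegrable (betaWeight (a - 1) (b - 1)) volume 0 1 := by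
  have half : ∀ {c d : ℝ}, 0 < c →
      IntervalIntegrable (betaWeight (c - 1) (d - 1)) volume 0 (1 / 2) := by
    intro c d hc
    refine IntervalIntegrable.mul_continuousOn (f := fun u => u ^ (c - 1))
      (intervalIntegral.intervalIntegrable_rpow' (by linarith)) ?_
    refine ContinuousOn.rpow_const (by fun_prop) fun x hx => .inl ?_
    rw [uIcc_of_le (by norm_num)] at hx
    linarith [hx.2]
  refine (half ha).trans ?_
  have h := (half (d := a) hb).comp_sub_left 1
  norm_num at h
  have e : (fun x => betaWeight (b - 1) (a - 1) (1 - x)) = betaWeight (a - 1) (b - 1) :=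
    funext fun x => betaWeight_one_sub x
  rw [e] at h
  exact h.symm

lemma intervalIntegrable_betaWeight_mul (ha : 0 < a) (hb : 0 < b) {p : ℝ → ℝ}
    (hp : ContinuousOn p (Icc 0 1)) {x y : ℝ} (hx : x ∈ Icc (0 : ℝ) 1) (hy : y ∈ Icc (0 : ℝ) 1) :
    IntervalIntegrable (fun u => betaWeight (a - 1) (b - 1) u * p u) volume x y := by
  have h : IntervalIntegrable (fun u => betaWeight (a - 1) (b - 1) u * p u) volume 0 1 :=
    (intervalIntegrable_betaWeight ha hb).mul_continuousOn (by rwa [uIcc_of_le zero_le_one])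
  refine h.mono_set ?_
  rw [uIcc_of_le zero_le_one]
  exact uIcc_subset_Icc hx hy

lemma integral_affine_mul_betaWeight (ha : 0 < a) (hb : 0 < b) {w : ℝ}
    (hw : w ∈ Icc (0 : ℝ) 1) :
    ∫ u in (0 : ℝ)..w, betaWeight (a - 1) (b - 1) u * (a - (a + b) * u) = betaWeight a b w := by
  rw [intervalIntegral.integral_eq_sub_of_hasDerivAt_of_le hw.1
    (continuous_betaWeight ha hb).continuousOn
    (fun x hx => (hasDerivAt_betaWeight ⟨hx.1, hx.2.trans_le hw.2⟩).congr_deriv (mul_comm _ _))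
    (intervalIntegrable_betaWeight_mul ha hb (by fun_prop) ⟨le_rfl, zero_le_one⟩ hw),
    betaWeight_zero ha, sub_zero]

lemma integral_betaWeight_mul_nonpos_of_monotoneOn (ha : 0 < a) (hb : 0 < b) {p : ℝ → ℝ}
    (hp : ContinuousOn p (Icc 0 1)) (hmono : MonotoneOn p (Icc 0 1))
    (hzero : ∫ u in (0 : ℝ)..1, betaWeight (a - 1) (b - 1) u * p u = 0) {w : ℝ}
    (hw : w ∈ Icc (0 : ℝ) 1) :
    ∫ u in (0 : ℝ)..w, betaWeight (a - 1) (b - 1) u * p u ≤ 0 := by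
  rcases le_total (p w) 0 with h | h
  · rw [← neg_nonneg, ← intervalIntegral.integral_neg]
    refine intervalIntegral.integral_nonneg hw.1 fun u hu => ?_
    have hu' : u ∈ Icc (0 : ℝ) 1 := ⟨hu.1, hu.2.trans hw.2⟩
    have := hmono hu' hw hu.2
    nlinarith [betaWeight_nonneg (a := a - 1) (b := b - 1) hu']
  · rw [← intervalIntegral.integral_add_adjacent_intervals
      (intervalIntegrable_betaWeight_mul ha hb hp ⟨le_rfl, zero_le_one⟩ hw)
      (intervalIntegrable_betaWeight_mul ha hb hp hw ⟨zero_le_one, le_rfl⟩)] at hzero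
    have : 0 ≤ ∫ u in w..1, betaWeight (a - 1) (b - 1) u * p u := by
      refine intervalIntegral.integral_nonneg hw.2 fun u hu => ?_
      have hu' : u ∈ Icc (0 : ℝ) 1 := ⟨hw.1.trans hu.1, hu.2⟩
      exact mul_nonneg (betaWeight_nonneg hu') (h.trans (hmono hw hu' hu.1))
    linarith

lemma integral_deriv_betaWeight_mul_le_of_monotoneOn (ha : 0 < a) (hb : 0 < b) {p : ℝ → ℝ}
    (hp : ContinuousOn p (Icc 0 1)) (hmono : MonotoneOn p (Icc 0 1)) {w : ℝ}
    (hw : w ∈ Icc (0 : ℝ) 1) :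
    ∫ u in (0 : ℝ)..w, betaWeight (a - 1) (b - 1) u * ((a - (a + b) * u) * p u)
      ≤ betaWeight a b w * p w := by
  have hs : 0 < a + b := add_pos ha hb
  set m := min (a / (a + b)) w
  have hm : m ∈ Icc (0 : ℝ) 1 := ⟨le_min (by positivity) hw.1, (min_le_right _ _).trans hw.2⟩
  have hmw : p m ≤ p w := hmono hm hw (min_le_right _ _)
  have h0 : (0 : ℝ) ∈ Icc (0 : ℝ) 1 := ⟨le_rfl, zero_le_one⟩
  calc ∫ u in (0 : ℝ)..w, betaWeight (a - 1) (b - 1) u * ((a - (a + b) * u) * p u)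
      ≤ ∫ u in (0 : ℝ)..w, betaWeight (a - 1) (b - 1) u * (a - (a + b) * u) * p m := by
        refine intervalIntegral.integral_mono_on hw.1
          (intervalIntegrable_betaWeight_mul ha hb (by fun_prop) h0 hw)
          ((intervalIntegrable_betaWeight_mul ha hb (by fun_prop) h0 hw).mul_const _) ?_
        intro u hu
        have hu' : u ∈ Icc (0 : ℝ) 1 := ⟨hu.1, hu.2.trans hw.2⟩
        rw [mul_assoc]
        refine mul_le_mul_of_nonneg_left ?_ (betaWeight_nonneg hu')
        rcases le_total u (a / (a + b)) with h | h
        · have h₁ : p u ≤ p m := hmono hu' hm (le_min h hu.2)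
          rw [le_div_iff₀ hs] at h
          exact mul_le_mul_of_nonneg_left h₁ (by linarith)
        · have h₁ : p m ≤ p u := hmono hm hu' ((min_le_left _ _).trans h)
          rw [div_le_iff₀ hs] at h
          exact mul_le_mul_of_nonpos_left h₁ (by linarith)
    _ = betaWeight a b w * p m := by
        rw [intervalIntegral.integral_mul_const, integral_affine_mul_betaWeight ha hb hw]
    _ ≤ betaWeight a b w * p w := mul_le_mul_of_nonneg_left hmw (betaWeight_nonneg hw)

lemma integral_deriv_betaWeight_mul_id (ha : 0 < a) (hb : 0 < b) {w : ℝ}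
    (hw : w ∈ Icc (0 : ℝ) 1) :
    ∫ u in (0 : ℝ)..w, betaWeight (a - 1) (b - 1) u * ((a - (a + b) * u) * u)
      = betaWeight a b w * w - ∫ u in (0 : ℝ)..w, betaWeight a b u := by
  have h0 : (0 : ℝ) ∈ Icc (0 : ℝ) 1 := ⟨le_rfl, zero_le_one⟩
  have hcont := continuous_betaWeight ha hb
  have hint : IntervalIntegrable
      (fun u => betaWeight (a - 1) (b - 1) u * ((a - (a + b) * u) * u)) volume 0 w :=
    intervalIntegrable_betaWeight_mul ha hb (by fun_prop) h0 hw
  have h := intervalIntegral.integral_eq_sub_of_hasDerivAt_of_le hw.1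
    (f := fun u => betaWeight a b u * u)
    (f' := fun u => betaWeight (a - 1) (b - 1) u * ((a - (a + b) * u) * u) + betaWeight a b u)
    (hcont.mul continuous_id).continuousOn
    (fun x hx => ((hasDerivAt_betaWeight ⟨hx.1, hx.2.trans_le hw.2⟩).mul
      (hasDerivAt_id x)).congr_deriv (by simp only [id]; ring))
    (hint.add (hcont.intervalIntegrable _ _))
  rw [intervalIntegral.integral_add hint (hcont.intervalIntegrable _ _)] at h
  linarith

/-- For `w` up to the mean of `B(a + 1, b + 1)`, the left tail is at most twice
`w (1 - w)` times the density. -/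
lemma integral_betaWeight_le (ha : 0 < a) (hb : 0 < b) {w : ℝ} (hw : w ∈ Ioo (0 : ℝ) 1)
    (hmean : (b + 1) * w ≤ (a + 1) * (1 - w)) :
    ∫ u in (0 : ℝ)..w, betaWeight a b u ≤ 2 * (w * (1 - w) * betaWeight a b w) := by
  have hcont := continuous_betaWeight ha hb
  have h := intervalIntegral.integral_le_sub_of_hasDeriv_right_of_le hw.1.le
    (g := fun u => betaWeight (a + 1) (b + 1) u
      + (b + 1) / (a + 1) * betaWeight (a + 1 + 1) b u)
    (φ := betaWeight a b)
    ((continuous_betaWeight (by linarith) (by linarith)).add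
      (continuous_const.mul (continuous_betaWeight (by linarith) hb))).continuousOn
    (fun x hx => ((hasDerivAt_betaWeight ⟨hx.1, hx.2.trans hw.2⟩).add
      ((hasDerivAt_betaWeight ⟨hx.1, hx.2.trans hw.2⟩).const_mul _)).hasDerivWithinAt)
    hcont.continuousOn.integrableOn_Icc ?_
  · refine h.trans ?_
    simp only [betaWeight_zero (add_pos ha one_pos),
      betaWeight_zero (add_pos (add_pos ha one_pos) one_pos), mul_zero, add_zero, sub_zero]
    rw [betaWeight_add_one_left hw, betaWeight_add_one_right hw, betaWeight_add_one_left hw,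
      betaWeight_add_one_left hw]
    have h₁ : (b + 1) / (a + 1) * w ≤ 1 - w := by
      rw [div_mul_eq_mul_div, div_le_iff₀ (by linarith)]; linarith
    have h₂ : 0 ≤ w * betaWeight a b w := mul_nonneg hw.1.le (betaWeight_pos hw).le
    nlinarith [mul_le_mul_of_nonneg_right h₁ h₂]
  · intro u hu
    have hu' : u ∈ Ioo (0 : ℝ) 1 := ⟨hu.1, hu.2.trans hw.2⟩
    have h1u : 0 < 1 - u := by linarith [hu'.2]
    have hT := betaWeight_pos (a := a) (b := b) hu'
    have e : betaWeight (a + 1) (b - 1) u = u / (1 - u) * betaWeight a b u := by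
      have := betaWeight_add_one_right (a := a) (b := b - 1) hu'
      rw [sub_add_cancel] at this
      rw [betaWeight_add_one_left hu', this]
      field_simp
    simp only [add_sub_cancel_right, e]
    have hρ : (b + 1) * u ≤ (a + 1) * (1 - u) := by nlinarith [hu.2]
    have key : 0 ≤ ((a + 1 - (a + 1 + (b + 1)) * u)
        + (b + 1) / (a + 1) * ((a + 1 + 1 - (a + 1 + 1 + b) * u) * (u / (1 - u)))) - 1 := by
      have : ((a + 1 - (a + 1 + (b + 1)) * u)
          + (b + 1) / (a + 1) * ((a + 1 + 1 - (a + 1 + 1 + b) * u) * (u / (1 - u)))) - 1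
          = ((a + 1) * (1 - u) - (b + 1) * u) * (a * (1 - u) + b * u)
            / ((a + 1) * (1 - u)) := by
        field_simp
        ring
      rw [this]
      have := hu.1
      exact div_nonneg (mul_nonneg (by linarith) (by positivity)) (by positivity)
    nlinarith [mul_nonneg key hT.le]

/-- Integration by parts for the primitive of `betaWeight (a - 1) (b - 1) * g`. -/
lemma integral_deriv_betaWeight_mul_eq (ha : 0 < a) (hb : 0 < b) {g : ℝ → ℝ}
    (hg : ContinuousOn g (Icc 0 1)) {w : ℝ} (hw : w ∈ Icc (0 : ℝ) 1) :
    ∫ u in (0 : ℝ)..w, betaWeight (a - 1) (b - 1) u * ((a - (a + b) * u) * g u)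
      = (a - (a + b) * w) * (∫ u in (0 : ℝ)..w, betaWeight (a - 1) (b - 1) u * g u)
        + (a + b) * ∫ x in (0 : ℝ)..w, ∫ u in (0 : ℝ)..x, betaWeight (a - 1) (b - 1) u * g u := by
  have h0 : (0 : ℝ) ∈ Icc (0 : ℝ) 1 := ⟨le_rfl, zero_le_one⟩
  set I : ℝ → ℝ := fun x => ∫ u in (0 : ℝ)..x, betaWeight (a - 1) (b - 1) u * g u
  have hI : ContinuousOn I (Icc 0 w) := by
    have := intervalIntegral.continuousOn_primitive_interval'
      (intervalIntegrable_betaWeight_mul ha hb hg h0 hw) left_mem_uIcc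
    rwa [uIcc_of_le hw.1] at this
  have hIint : IntervalIntegrable I volume 0 w :=
    ContinuousOn.intervalIntegrable (by rwa [uIcc_of_le hw.1])
  have hint : IntervalIntegrable
      (fun u => betaWeight (a - 1) (b - 1) u * ((a - (a + b) * u) * g u)) volume 0 w :=
    intervalIntegrable_betaWeight_mul ha hb (by fun_prop) h0 hw
  have hIderiv : ∀ x ∈ Ioo (0 : ℝ) 1,
      HasDerivAt I (betaWeight (a - 1) (b - 1) x * g x) x := by
    intro x hx
    have hc : ContinuousOn (fun u => betaWeight (a - 1) (b - 1) u * g u) (Ioo 0 1) :=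
      ContinuousOn.mul (fun y hy => (hasDerivAt_betaWeight hy).continuousAt.continuousWithinAt)
        (hg.mono Ioo_subset_Icc_self)
    exact intervalIntegral.integral_hasDerivAt_right
      (intervalIntegrable_betaWeight_mul ha hb hg h0 ⟨hx.1.le, hx.2.le⟩)
      (hc.stronglyMeasurableAtFilter isOpen_Ioo x hx) (hc.continuousAt (isOpen_Ioo.mem_nhds hx))
  have h := intervalIntegral.integral_eq_sub_of_hasDerivAt_of_le hw.1
    (f := fun u => (a - (a + b) * u) * I u)
    (f' := fun u => betaWeight (a - 1) (b - 1) u * ((a - (a + b) * u) * g u) - (a + b) * I u)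
    (by fun_prop)
    (fun x hx => ((((hasDerivAt_id x).const_mul (a + b)).const_sub a).mul
      (hIderiv x ⟨hx.1, hx.2.trans_le hw.2⟩)).congr_deriv (by simp only [id]; ring))
    (hint.sub (hIint.const_mul _))
  rw [intervalIntegral.integral_sub hint (hIint.const_mul _),
    intervalIntegral.integral_const_mul] at h
  have hI0 : I 0 = 0 := intervalIntegral.integral_same
  rw [hI0] at h
  linarith

variable {g : ℝ → ℝ} {L : ℝ}

lemma continuousOn_of_abs_sub_le
    (hg : ∀ x ∈ Icc (0 : ℝ) 1, ∀ y ∈ Icc (0 : ℝ) 1, |g x - g y| ≤ L * |x - y|) :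
    ContinuousOn g (Icc 0 1) :=
  (LipschitzOnWith.of_dist_le' (K := L) fun x hx y hy => by
    simpa [Real.dist_eq] using hg x hx y hy).continuousOn

lemma monotoneOn_mul_add_of_abs_sub_le
    (hg : ∀ x ∈ Icc (0 : ℝ) 1, ∀ y ∈ Icc (0 : ℝ) 1, |g x - g y| ≤ L * |x - y|)
    {σ : ℝ} (hσ : |σ| = 1) (c : ℝ) :
    MonotoneOn (fun x => L * (x - c) + σ * g x) (Icc 0 1) := by
  intro x hx y hy hxy
  have h := hg x hx y hy
  rw [abs_sub_comm x, abs_of_nonneg (sub_nonneg.2 hxy)] at h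
  have h₂ : σ * (g x - g y) ≤ L * (y - x) :=
    (le_abs_self _).trans (by rwa [abs_mul, hσ, one_mul])
  simp only
  linarith

lemma abs_integral_betaWeight_mul_le (ha : 0 < a) (hb : 0 < b)
    (hg : ∀ x ∈ Icc (0 : ℝ) 1, ∀ y ∈ Icc (0 : ℝ) 1, |g x - g y| ≤ L * |x - y|)
    (hzero : ∫ u in (0 : ℝ)..1, betaWeight (a - 1) (b - 1) u * g u = 0) {w : ℝ}
    (hw : w ∈ Icc (0 : ℝ) 1) :
    (a + b) * |∫ u in (0 : ℝ)..w, betaWeight (a - 1) (b - 1) u * g u| ≤ L * betaWeight a b w := by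
  have hs : 0 < a + b := add_pos ha hb
  have hgc := continuousOn_of_abs_sub_le hg
  have h0 : (0 : ℝ) ∈ Icc (0 : ℝ) 1 := ⟨le_rfl, zero_le_one⟩
  have split : ∀ σ : ℝ, ∀ x ∈ Icc (0 : ℝ) 1,
      ∫ u in (0 : ℝ)..x, betaWeight (a - 1) (b - 1) u * (L * (u - a / (a + b)) + σ * g u)
        = -(L / (a + b)) * betaWeight a b x
          + σ * ∫ u in (0 : ℝ)..x, betaWeight (a - 1) (b - 1) u * g u := by
    intro σ x hx
    rw [← integral_affine_mul_betaWeight ha hb hx, ← intervalIntegral.integral_const_mul,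
      ← intervalIntegral.integral_const_mul, ← intervalIntegral.integral_add
        ((intervalIntegrable_betaWeight_mul ha hb (by fun_prop) h0 hx).const_mul _)
        ((intervalIntegrable_betaWeight_mul ha hb hgc h0 hx).const_mul _)]
    congr 1 with u
    field_simp
    ring
  have bound : ∀ σ : ℝ, |σ| = 1 →
      σ * (∫ u in (0 : ℝ)..w, betaWeight (a - 1) (b - 1) u * g u)
        ≤ L / (a + b) * betaWeight a b w := by
    intro σ hσ
    have h := integral_betaWeight_mul_nonpos_of_monotoneOn ha hb
      (p := fun x => L * (x - a / (a + b)) + σ * g x) (by fun_prop)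
      (monotoneOn_mul_add_of_abs_sub_le hg hσ _)
      (by rw [split σ 1 ⟨zero_le_one, le_rfl⟩, hzero, betaWeight_one hb]; simp) hw
    rw [split σ w hw] at h
    linarith
  have h₁ := bound 1 (by simp)
  have h₂ := bound (-1) (by simp)
  have : |∫ u in (0 : ℝ)..w, betaWeight (a - 1) (b - 1) u * g u|
      ≤ L / (a + b) * betaWeight a b w := abs_le.2 ⟨by linarith, by linarith⟩
  calc _ ≤ (a + b) * (L / (a + b) * betaWeight a b w) := mul_le_mul_of_nonneg_left this hs.le
    _ = _ := by field_simp

lemma abs_betaWeight_mul_sub_integral_le (ha : 0 < a) (hb : 0 < b)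
    (hg : ∀ x ∈ Icc (0 : ℝ) 1, ∀ y ∈ Icc (0 : ℝ) 1, |g x - g y| ≤ L * |x - y|) {w : ℝ}
    (hw : w ∈ Icc (0 : ℝ) 1) :
    |betaWeight a b w * g w
      - ∫ u in (0 : ℝ)..w, betaWeight (a - 1) (b - 1) u * ((a - (a + b) * u) * g u)|
      ≤ L * ∫ u in (0 : ℝ)..w, betaWeight a b u := by
  have hgc := continuousOn_of_abs_sub_le hg
  have h0 : (0 : ℝ) ∈ Icc (0 : ℝ) 1 := ⟨le_rfl, zero_le_one⟩
  have bound : ∀ σ : ℝ, |σ| = 1 →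
      σ * (∫ u in (0 : ℝ)..w, betaWeight (a - 1) (b - 1) u * ((a - (a + b) * u) * g u))
        ≤ σ * (betaWeight a b w * g w) + L * ∫ u in (0 : ℝ)..w, betaWeight a b u := by
    intro σ hσ
    have h := integral_deriv_betaWeight_mul_le_of_monotoneOn ha hb
      (p := fun x => L * (x - 0) + σ * g x) (by fun_prop)
      (monotoneOn_mul_add_of_abs_sub_le hg hσ 0) hw
    have split :
        ∫ u in (0 : ℝ)..w, betaWeight (a - 1) (b - 1) u
            * ((a - (a + b) * u) * (L * (u - 0) + σ * g u))
          = L * (∫ u in (0 : ℝ)..w, betaWeight (a - 1) (b - 1) u * ((a - (a + b) * u) * u))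
            + σ * ∫ u in (0 : ℝ)..w,
                betaWeight (a - 1) (b - 1) u * ((a - (a + b) * u) * g u) := by
      rw [← intervalIntegral.integral_const_mul,
        ← intervalIntegral.integral_const_mul, ← intervalIntegral.integral_add
          ((intervalIntegrable_betaWeight_mul ha hb (by fun_prop) h0 hw).const_mul _)
          ((intervalIntegrable_betaWeight_mul ha hb (by fun_prop) h0 hw).const_mul _)]
      congr 1 with u
      ring
    rw [split, integral_deriv_betaWeight_mul_id ha hb hw] at h
    linarith
  have h₁ := bound 1 (by simp)
  have h₂ := bound (-1) (by simp)
  exact abs_le.2 ⟨by linarith, by linarith⟩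

lemma abs_stein_derivative_le_of_le_mean (ha : 0 < a) (hb : 0 < b) (hL : 0 ≤ L)
    (hg : ∀ x ∈ Icc (0 : ℝ) 1, ∀ y ∈ Icc (0 : ℝ) 1, |g x - g y| ≤ L * |x - y|)
    (hzero : ∫ u in (0 : ℝ)..1, betaWeight (a - 1) (b - 1) u * g u = 0) {w : ℝ}
    (hw : w ∈ Ioo (0 : ℝ) 1) (hmean : (b + 1) * w ≤ (a + 1) * (1 - w)) :
    |betaWeight a b w * g w
      - (a - (a + b) * w) * ∫ u in (0 : ℝ)..w, betaWeight (a - 1) (b - 1) u * g u|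
      ≤ 4 * L * (w * (1 - w) * betaWeight a b w) := by
  have hw' : w ∈ Icc (0 : ℝ) 1 := ⟨hw.1.le, hw.2.le⟩
  have h₁ := abs_betaWeight_mul_sub_integral_le ha hb hg hw'
  rw [integral_deriv_betaWeight_mul_eq ha hb (continuousOn_of_abs_sub_le hg) hw'] at h₁
  have h₂ : |(a + b) * ∫ x in (0 : ℝ)..w,
      ∫ u in (0 : ℝ)..x, betaWeight (a - 1) (b - 1) u * g u|
      ≤ L * ∫ u in (0 : ℝ)..w, betaWeight a b u := by
    rw [← intervalIntegral.integral_const_mul, ← intervalIntegral.integral_const_mul,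
      ← Real.norm_eq_abs]
    refine intervalIntegral.norm_integral_le_of_norm_le hw.1.le
      (Filter.Eventually.of_forall fun x hx => ?_)
      (((continuous_betaWeight ha hb).intervalIntegrable _ _).const_mul _)
    rw [Real.norm_eq_abs, abs_mul, abs_of_pos (add_pos ha hb)]
    exact abs_integral_betaWeight_mul_le ha hb hg hzero ⟨hx.1.le, hx.2.trans hw.2.le⟩
  have h₃ := mul_le_mul_of_nonneg_left (integral_betaWeight_le ha hb hw hmean) hL
  rw [abs_le] at h₁ h₂ ⊢
  constructor <;> linarith [h₁.1, h₁.2, h₂.1, h₂.2]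

/-- The left-hand side is `w (1 - w) f'(w)` times `betaWeight a b w`, where `f` is the solution of
the Beta Stein equation with right-hand side `g`. -/
lemma abs_stein_derivative_le (ha : 0 < a) (hb : 0 < b) (hL : 0 ≤ L)
    (hg : ∀ x ∈ Icc (0 : ℝ) 1, ∀ y ∈ Icc (0 : ℝ) 1, |g x - g y| ≤ L * |x - y|)
    (hzero : ∫ u in (0 : ℝ)..1, betaWeight (a - 1) (b - 1) u * g u = 0) {w : ℝ}
    (hw : w ∈ Ioo (0 : ℝ) 1) :
    |betaWeight a b w * g w
      - (a - (a + b) * w) * ∫ u in (0 : ℝ)..w, betaWeight (a - 1) (b - 1) u * g u|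
      ≤ 4 * L * (w * (1 - w) * betaWeight a b w) := by
  rcases le_total ((b + 1) * w) ((a + 1) * (1 - w)) with hmean | hmean
  · exact abs_stein_derivative_le_of_le_mean ha hb hL hg hzero hw hmean
  have reflect : ∀ x : ℝ,
      ∫ u in (0 : ℝ)..x, betaWeight (b - 1) (a - 1) u * g (1 - u)
        = ∫ u in (1 - x)..1, betaWeight (a - 1) (b - 1) u * g u := by
    intro x
    have h := intervalIntegral.integral_comp_sub_left (a := 0) (b := x)
      (fun u => betaWeight (a - 1) (b - 1) u * g u) 1
    simpa only [betaWeight_one_sub, sub_zero] using h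
  have h := abs_stein_derivative_le_of_le_mean (g := fun u => g (1 - u)) hb ha hL
    (fun x hx y hy => by
      have := hg (1 - x) ⟨by linarith [hx.2], by linarith [hx.1]⟩
        (1 - y) ⟨by linarith [hy.2], by linarith [hy.1]⟩
      rwa [sub_sub_sub_cancel_left, abs_sub_comm y x] at this)
    (by rw [reflect, sub_self, hzero])
    (w := 1 - w) ⟨by linarith [hw.2], by linarith [hw.1]⟩ (by linarith)
  rw [reflect, betaWeight_one_sub, sub_sub_cancel] at h
  have hgc := continuousOn_of_abs_sub_le hg
  rw [← intervalIntegral.integral_add_adjacent_intervals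
    (intervalIntegrable_betaWeight_mul ha hb hgc ⟨le_rfl, zero_le_one⟩ ⟨hw.1.le, hw.2.le⟩)
    (intervalIntegrable_betaWeight_mul ha hb hgc ⟨hw.1.le, hw.2.le⟩ ⟨zero_le_one, le_rfl⟩)]
    at hzero
  rw [← eq_neg_iff_add_eq_zero] at hzero
  rw [hzero]
  convert h using 2 <;> ring

/-- The total mass of the Beta weight is the Beta function. -/
lemma integral_betaWeight (ha : 0 < a) (hb : 0 < b) :
    ∫ u in (0 : ℝ)..1, betaWeight (a - 1) (b - 1) u
      = Real.Gamma a * Real.Gamma b / Real.Gamma (a + b) := by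
  have h := ProbabilityTheory.beta_eq_betaIntegralReal a b ha hb
  rw [ProbabilityTheory.beta] at h
  rw [h, Complex.betaIntegral]
  have : (∫ x : ℝ in 0..1, (x : ℂ) ^ ((a : ℂ) - 1) * (1 - (x : ℂ)) ^ ((b : ℂ) - 1))
      = ∫ x : ℝ in 0..1, ((betaWeight (a - 1) (b - 1) x : ℝ) : ℂ) := by
    refine intervalIntegral.integral_congr fun x hx => ?_
    rw [uIcc_of_le zero_le_one] at hx
    simp only [betaWeight, Complex.ofReal_mul]
    rw [Complex.ofReal_cpow hx.1, Complex.ofReal_cpow (by linarith [hx.2])]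
    push_cast
    rfl
  rw [this, intervalIntegral.integral_ofReal, Complex.ofReal_re]

lemma integral_betaWeight_mul_sub_betaExp (ha : 0 < a) (hb : 0 < b) {h : ℝ → ℝ}
    (hc : ContinuousOn h (Icc 0 1)) :
    ∫ u in (0 : ℝ)..1, betaWeight (a - 1) (b - 1) u * (h u - betaExp a b h) = 0 := by
  have h0 : (0 : ℝ) ∈ Icc (0 : ℝ) 1 := ⟨le_rfl, zero_le_one⟩
  have h1 : (1 : ℝ) ∈ Icc (0 : ℝ) 1 := ⟨zero_le_one, le_rfl⟩
  have e : betaExp a b h = Real.Gamma (a + b) / (Real.Gamma a * Real.Gamma b)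
      * ∫ u in (0 : ℝ)..1, betaWeight (a - 1) (b - 1) u * h u := by
    rw [betaExp, ← integral_Ioc_eq_integral_Ioo, ← intervalIntegral.integral_of_le zero_le_one,
      ← intervalIntegral.integral_const_mul]
    congr 1 with u
    simp only [betaWeight]
    ring
  simp only [mul_sub]
  rw [intervalIntegral.integral_sub (intervalIntegrable_betaWeight_mul ha hb hc h0 h1)
    (intervalIntegrable_betaWeight_mul ha hb continuousOn_const h0 h1),
    intervalIntegral.integral_mul_const, integral_betaWeight ha hb, e]
  have := Real.Gamma_pos_of_pos ha
  have := Real.Gamma_pos_of_pos hb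
  have := Real.Gamma_pos_of_pos (add_pos ha hb)
  field_simp
  ring

end BetaWeight

lemma b₀_nonneg (a b : ℝ) : 0 ≤ b₀ a b := by
  unfold b₀
  split_ifs with h₁ h₂ h₂
  · exact mul_nonneg (by norm_num) (le_max_of_le_left (abs_nonneg _))
  · exact mul_nonneg (sq_nonneg _) (le_max_of_le_left (by positivity))
  · exact mul_nonneg (sq_nonneg _) (le_max_of_le_right (by positivity))
  · exact mul_nonneg (sq_nonneg _) (le_max_of_le_left (one_div_nonneg.2 (by linarith)))

lemma four_le_sq_add_div_sq_min {x y : ℝ} (hx : 0 < x) (hy : 0 < y) :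
    4 ≤ (x + y) ^ 2 / min x y ^ 2 := by
  have hm : 0 < min x y := lt_min hx hy
  rw [le_div_iff₀ (by positivity)]
  nlinarith [min_le_left x y, min_le_right x y]

lemma six_le_b₁ {a b : ℝ} (ha : 0 < a) (hb : 0 < b) : 6 ≤ b₁ a b := by
  unfold b₁
  split_ifs with h₁ h₂ h₂
  · have : 1 / 2 ≤ max a b / (a + b) := by
      rw [le_div_iff₀ (by positivity)]
      linarith [le_max_left a b, le_max_right a b]
    linarith
  · have := four_le_sq_add_div_sq_min (x := a) (y := b - 2) ha (by linarith)
    rw [← add_sub_assoc] at this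
    linarith [le_max_left 1 (b / (b - 2))]
  · have := four_le_sq_add_div_sq_min (x := a - 2) (y := b) (by linarith) hb
    rw [sub_add_eq_add_sub] at this
    linarith [le_max_right (a / (a - 2)) 1]
  · have := four_le_sq_add_div_sq_min (x := a - 1) (y := b - 1) (by linarith) (by linarith)
    rw [show a - 1 + (b - 1) = a + b - 2 by ring] at this
    have h₃ : 1 ≤ a / (a - 1) := by rw [le_div_iff₀] <;> linarith
    linarith [le_max_left (a / (a - 1)) (b / (b - 1))]

/-- For `α, β > 0` and `h` Lipschitz with constant `L` on
`[0,1]` (equivalently `|h'| ≤ L` a.e.), the solution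
`f(w) = w^{-α}(1-w)^{-β} ∫₀^w u^{α-1}(1-u)^{β-1}(h(u) - Bh) du`
of the Beta Stein equation satisfies
`‖f'‖ ≤ b₀(α,β) ‖h - Bh‖ + b₁(α,β) L ≤ (b₀(α,β) + b₁(α,β)) L`,
where `‖h - Bh‖` is expressed via an arbitrary bound
`M ≥ sup_{x ∈ [0,1]} |h(x) - Bh|`. -/
theorem stmt_15 (α β : ℝ) (hα : 0 < α) (hβ : 0 < β)
    (L : ℝ) (hL : 0 ≤ L)
    (h : ℝ → ℝ)
    (hLip : ∀ x ∈ Set.Icc (0 : ℝ) 1, ∀ y ∈ Set.Icc (0 : ℝ) 1,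
      |h x - h y| ≤ L * |x - y|)
    (Bh : ℝ) (hBh : Bh = betaExp α β h)
    (f : ℝ → ℝ)
    (hfdef : ∀ w ∈ Set.Ioo (0 : ℝ) 1,
      f w = w ^ (-α) * (1 - w) ^ (-β)
        * ∫ u in (0 : ℝ)..w, u ^ (α - 1) * (1 - u) ^ (β - 1) * (h u - Bh)) :
    (∀ M : ℝ, (∀ x ∈ Set.Icc (0 : ℝ) 1, |h x - Bh| ≤ M) →
      ∀ w ∈ Set.Ioo (0 : ℝ) 1, ∀ d : ℝ, HasDerivAt f d w →
        |d| ≤ b₀ α β * M + b₁ α β * L) ∧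
    (∀ w ∈ Set.Ioo (0 : ℝ) 1, ∀ d : ℝ, HasDerivAt f d w →
      |d| ≤ (b₀ α β + b₁ α β) * L) := by
  have hc := continuousOn_of_abs_sub_le hLip
  have main : ∀ w ∈ Set.Ioo (0 : ℝ) 1, ∀ d : ℝ, HasDerivAt f d w → |d| ≤ 4 * L := by
    intro w hw d hd
    have hN := abs_stein_derivative_le (g := fun u => h u - Bh) hα hβ hL
      (fun x hx y hy => by simpa using hLip x hx y hy)
      (by rw [hBh]; exact integral_betaWeight_mul_sub_betaExp hα hβ hc) hw
    have hfT : ∀ x ∈ Set.Ioo (0 : ℝ) 1, f x * betaWeight α β x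
        = ∫ u in (0 : ℝ)..x, betaWeight (α - 1) (β - 1) u * (h u - Bh) := by
      intro x hx
      have h₁ : x ^ α ≠ 0 := (Real.rpow_pos_of_pos hx.1 _).ne'
      have h₂ : (1 - x) ^ β ≠ 0 := (Real.rpow_pos_of_pos (by linarith [hx.2]) _).ne'
      rw [hfdef x hx, Real.rpow_neg hx.1.le, Real.rpow_neg (by linarith [hx.2])]
      simp only [betaWeight]
      field_simp
    have hcg : ContinuousOn (fun u => betaWeight (α - 1) (β - 1) u * (h u - Bh))
        (Set.Ioo 0 1) :=
      ContinuousOn.mul (fun y hy => (hasDerivAt_betaWeight hy).continuousAt.continuousWithinAt)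
        ((hc.mono Set.Ioo_subset_Icc_self).sub continuousOn_const)
    have hderiv := (hd.mul (hasDerivAt_betaWeight (a := α) (b := β) hw)).unique
      ((intervalIntegral.integral_hasDerivAt_right
        (intervalIntegrable_betaWeight_mul (p := fun u => h u - Bh) hα hβ
          (hc.sub continuousOn_const)
          ⟨le_rfl, zero_le_one⟩ ⟨hw.1.le, hw.2.le⟩)
        (hcg.stronglyMeasurableAtFilter isOpen_Ioo w hw)
        (hcg.continuousAt (isOpen_Ioo.mem_nhds hw))).congr_of_eventuallyEq
          (Filter.eventually_of_mem (isOpen_Ioo.mem_nhds hw) hfT))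
    have hpos : 0 < w * (1 - w) * betaWeight α β w :=
      mul_pos (mul_pos hw.1 (by linarith [hw.2])) (betaWeight_pos hw)
    have hdN : betaWeight α β w * (h w - Bh) - (α - (α + β) * w)
        * ∫ u in (0 : ℝ)..w, betaWeight (α - 1) (β - 1) u * (h u - Bh)
        = d * (w * (1 - w) * betaWeight α β w) := by
      rw [← hfT w hw]
      have e := betaWeight_eq_mul_betaWeight_sub_one (a := α) (b := β) hw
      linear_combination (h w - Bh - (α - (α + β) * w) * f w) * e - w * (1 - w) * hderiv
    rw [hdN, abs_mul, abs_of_pos hpos] at hN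
    exact le_of_mul_le_mul_right hN hpos
  have hb₀ := b₀_nonneg α β
  have hb₁ := mul_le_mul_of_nonneg_right (six_le_b₁ hα hβ) hL
  refine ⟨fun M hM w hw d hd => ?_, fun w hw d hd => ?_⟩
  · have hM0 : 0 ≤ M := (abs_nonneg _).trans (hM 0 ⟨le_rfl, zero_le_one⟩)
    linarith [main w hw d hd, mul_nonneg hb₀ hM0]
  · linarith [main w hw d hd, mul_nonneg hb₀ hL]
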